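/- It is impossible to have positive integers x, a, b, c with x² + x + 1 = (a² + a + 1)(b² + b + 1)(c² + c + 1) such that all seven of the numbers x, a, b, c, a² + a + 1, b² + b + 1 and c² + c + 1 are prime. -/

import Mathlib

/-- If the prime `a² + a + 1` divides the Eisenstein norm of `u - vω`, then one of the two conjugate
primes `A - ω`, with `A = a` or `A = -1 - a`, divides `u - vω`. -/
lemma exists_eisenstein_factor {a m u v : ℤ} (hp : Prime (a ^ 2 + a + 1))
    (h : u ^ 2 + u * v + v ^ 2 = (a ^ 2 + a + 1) * m) :
    ∃ A u' v' : ℤ, (A = a ∨ A = -1 - a) ∧ u = A * u' - v' ∧ v = A * v' + u' + v' ∧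
      u' ^ 2 + u' * v' + v' ^ 2 = m := by
  obtain ⟨A, hA, k, hk⟩ : ∃ A : ℤ, (A = a ∨ A = -1 - a) ∧ a ^ 2 + a + 1 ∣ u - A * v := by
    have hd : a ^ 2 + a + 1 ∣ (u - a * v) * (u - (-1 - a) * v) :=
      ⟨m - v ^ 2, by linear_combination h⟩
    rcases hp.dvd_or_dvd hd with hd | hd
    · exact ⟨a, Or.inl rfl, hd⟩
    · exact ⟨-1 - a, Or.inr rfl, hd⟩
  have hN : a ^ 2 + a + 1 = A ^ 2 + A + 1 := by
    rcases hA with rfl | rfl <;> ring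
  rw [hN] at hk h hp
  have hu : u = A * ((A + 1) * k + v) - -k := by linear_combination hk
  refine ⟨A, (A + 1) * k + v, -k, hA, hu, by ring, mul_left_cancel₀ hp.ne_zero ?_⟩
  rw [← h, hu]
  ring

lemma eisenstein_unit_cases {u v : ℤ} (h : u ^ 2 + u * v + v ^ 2 = 1) :
    (u = 1 ∧ v = 0) ∨ (u = -1 ∧ v = 0) ∨ (u = 0 ∧ v = 1) ∨ (u = 0 ∧ v = -1) ∨
      (u = 1 ∧ v = -1) ∨ (u = -1 ∧ v = 1) := by
  have h1 : u ≤ 1 := by nlinarith [sq_nonneg (u + 2 * v)]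
  have h2 : -1 ≤ u := by nlinarith [sq_nonneg (u + 2 * v)]
  have h3 : v ≤ 1 := by nlinarith [sq_nonneg (v + 2 * u)]
  have h4 : -1 ≤ v := by nlinarith [sq_nonneg (v + 2 * u)]
  interval_cases u <;> interval_cases v <;> simp_all

lemma eq_two_of_mul_mul_le {p q r : ℤ} (hp : 2 ≤ p) (hq : 2 ≤ q) (hr : 2 ≤ r)
    (h : p * q * r ≤ p + q + r + 2) : p = 2 ∧ q = 2 ∧ r = 2 := by
  obtain ⟨i, rfl⟩ := Int.le.dest hp
  obtain ⟨j, rfl⟩ := Int.le.dest hq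
  obtain ⟨k, rfl⟩ := Int.le.dest hr
  have h1 : (0 : ℤ) ≤ (i : ℤ) * j := by positivity
  have h2 : (0 : ℤ) ≤ (i : ℤ) * k := by positivity
  have h3 : (0 : ℤ) ≤ (j : ℤ) * k := by positivity
  have h4 : (0 : ℤ) ≤ (i : ℤ) * j * k := by positivity
  refine ⟨?_, ?_, ?_⟩ <;> nlinarith

lemma abs_eq_two_of_mul_mul_eq_add {A B C : ℤ} (hA : 2 ≤ |A|) (hB : 2 ≤ |B|) (hC : 2 ≤ |C|)
    (h : A * B * C = A + B + C ∨ A * B * C = A + B + C + 2) : |A| = 2 ∧ |B| = 2 ∧ |C| = 2 := by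
  refine eq_two_of_mul_mul_le hA hB hC ?_
  rw [← abs_mul, ← abs_mul]
  have hs := abs_add_three A B C
  rcases h with h | h <;> rw [h]
  · linarith
  · have := abs_add_le (A + B + C) 2
    norm_num at this
    linarith

lemma eq_two_or_three_or_mod_six {a : ℕ} (ha : a.Prime) (hN : (a ^ 2 + a + 1).Prime) :
    a = 2 ∨ a = 3 ∨ a % 6 = 5 := by
  by_cases h2 : a = 2
  · exact Or.inl h2
  by_cases h3 : a = 3
  · exact Or.inr (Or.inl h3)
  have m2 : ¬ 2 ∣ a := fun h => h2 ((Nat.prime_dvd_prime_iff_eq Nat.prime_two ha).1 h).symm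
  have m3 : ¬ 3 ∣ a := fun h => h3 ((Nat.prime_dvd_prime_iff_eq Nat.prime_three ha).1 h).symm
  have m1 : a % 3 ≠ 1 := by
    intro h
    have hd : 3 ∣ a ^ 2 + a + 1 := by
      apply Nat.dvd_of_mod_eq_zero
      simp [Nat.add_mod, Nat.pow_mod, h]
    have := (Nat.prime_dvd_prime_iff_eq Nat.prime_three hN).1 hd
    have := ha.two_le
    nlinarith
  omega

lemma prime_mul_ne_mul_add {a b c : ℕ} (ha : a.Prime) (hb : b.Prime) (hc : c.Prime) :
    b * c ≠ a * (b + c + 1) := by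
  intro h
  have hd : a ∣ b * c := ⟨_, h⟩
  rcases (Nat.Prime.dvd_mul ha).1 hd with hd | hd
  · have := (Nat.prime_dvd_prime_iff_eq ha hb).1 hd
    subst this
    have := Nat.eq_of_mul_eq_mul_left ha.pos h
    omega
  · have := (Nat.prime_dvd_prime_iff_eq ha hc).1 hd
    subst this
    rw [mul_comm b] at h
    have := Nat.eq_of_mul_eq_mul_left ha.pos h
    omega

lemma mul_ne_mul_add_add_two {a b c : ℕ} (ha : a = 2 ∨ a = 3 ∨ a % 6 = 5)
    (hb : b = 2 ∨ b = 3 ∨ b % 6 = 5) (hc : c = 2 ∨ c = 3 ∨ c % 6 = 5) :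
    b * c ≠ a * (b + c + 1) + 2 := by
  intro h
  have ha2 : 2 ≤ a := by omega
  have hab : a < b := by
    by_contra! hle
    nlinarith [Nat.mul_le_mul_right c hle, Nat.zero_le (a * b)]
  have hac : a < c := by
    by_contra! hle
    nlinarith [Nat.mul_le_mul_right b hle, Nat.zero_le (a * c)]
  have hb' : b = 3 ∨ b % 6 = 5 := by omega
  have hc' : c = 3 ∨ c % 6 = 5 := by omega
  rcases hb' with rfl | hb'
  · have : a = 2 := by omega
    subst this
    omega
  rcases hc' with rfl | hc'
  · have : a = 2 := by omega
    subst this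
    omega
  rcases ha with rfl | rfl | ha
  · have hb5 : b ≤ 6 ∨ c ≤ 6 := by
      by_contra! hlt
      nlinarith [Nat.mul_le_mul hlt.1 hlt.2]
    rcases hb5 with hlt | hlt
    · have : b = 5 := by omega
      subst this
      omega
    · have : c = 5 := by omega
      subst this
      omega
  · have hb5 : b ≤ 7 ∨ c ≤ 7 := by
      by_contra! hlt
      nlinarith [Nat.mul_le_mul hlt.1 hlt.2]
    rcases hb5 with hlt | hlt
    · have : b = 5 := by omega
      subst this
      omega
    · have : c = 5 := by omega
      subst this
      omega
  · have := congrArg (· % 6) h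
    simp [Nat.add_mod, Nat.mul_mod, ha, hb', hc'] at this

/-- There are no "triple threats": it is impossible to have
`x² + x + 1 = (a² + a + 1)(b² + b + 1)(c² + c + 1)` with all seven of
`x, a, b, c, a² + a + 1, b² + b + 1, c² + c + 1` prime. -/
theorem no_triple_threat :
    ¬ ∃ x a b c : ℕ, 0 < x ∧ 0 < a ∧ 0 < b ∧ 0 < c ∧
      Nat.Prime x ∧ Nat.Prime a ∧ Nat.Prime b ∧ Nat.Prime c ∧
      Nat.Prime (a ^ 2 + a + 1) ∧ Nat.Prime (b ^ 2 + b + 1) ∧ Nat.Prime (c ^ 2 + c + 1) ∧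
      x ^ 2 + x + 1 = (a ^ 2 + a + 1) * (b ^ 2 + b + 1) * (c ^ 2 + c + 1) := by
  rintro ⟨x, a, b, c, -, -, -, -, hx, ha, hb, hc, hpa, hpb, hpc, h⟩
  have hneg : ∀ p q r : ℕ, p.Prime → q.Prime → r.Prime → (p ^ 2 + p + 1).Prime →
      (q ^ 2 + q + 1).Prime → (r ^ 2 + r + 1).Prime →
      (q * r : ℤ) ≠ p * (q + r + 1) ∧ (q * r : ℤ) ≠ p * (q + r + 1) + 2 := by
    intro p q r hp hq hr hp' hq' hr'
    exact ⟨mod_cast prime_mul_ne_mul_add hp hq hr,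
      mod_cast mul_ne_mul_add_add_two (eq_two_or_three_or_mod_six hp hp')
        (eq_two_or_three_or_mod_six hq hq') (eq_two_or_three_or_mod_six hr hr')⟩
  obtain ⟨hA0, hA2⟩ := hneg a b c ha hb hc hpa hpb hpc
  obtain ⟨hB0, hB2⟩ := hneg b a c hb ha hc hpb hpa hpc
  obtain ⟨hC0, hC2⟩ := hneg c a b hc ha hb hpc hpa hpb
  have hne : ¬ (a = 2 ∧ b = 2 ∧ c = 2) := by
    rintro ⟨rfl, rfl, rfl⟩
    have : x = 18 := by nlinarith
    subst this
    norm_num at hx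
  have ha2 : (2 : ℤ) ≤ a := mod_cast ha.two_le
  have hb2 : (2 : ℤ) ≤ b := mod_cast hb.two_le
  have hc2 : (2 : ℤ) ≤ c := mod_cast hc.two_le
  have hZ : ((x : ℤ) ^ 2 + x * 1 + 1 ^ 2) =
      (a ^ 2 + a + 1) * ((b ^ 2 + b + 1) * (c ^ 2 + c + 1)) := by
    have : ((x : ℤ) ^ 2 + x + 1) = (a ^ 2 + a + 1) * (b ^ 2 + b + 1) * (c ^ 2 + c + 1) :=
      mod_cast h
    linear_combination this
  obtain ⟨A, u₁, v₁, hA, -, hv, h₁⟩ :=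
    exists_eisenstein_factor (mod_cast Nat.prime_iff_prime_int.1 hpa) hZ
  obtain ⟨B, u₂, v₂, hB, hu₁, hv₁, h₂⟩ :=
    exists_eisenstein_factor (mod_cast Nat.prime_iff_prime_int.1 hpb) h₁
  obtain ⟨C, u₃, v₃, hC, hu₂, hv₂, h₃⟩ :=
    exists_eisenstein_factor (m := 1) (mod_cast Nat.prime_iff_prime_int.1 hpc)
      (h₂.trans (mul_one _).symm)
  have hsmall : ∀ D E F : ℤ, (D = a ∨ D = -1 - a) → (E = b ∨ E = -1 - b) →
      (F = c ∨ F = -1 - c) → ¬ (D * E * F = D + E + F ∨ D * E * F = D + E + F + 2) := by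
    intro D E F hD hE hF hDEF
    have key : ∀ n X : ℤ, 2 ≤ n → (X = n ∨ X = -1 - n) → 2 ≤ |X| ∧ (|X| = 2 → n = 2) := by
      rintro n X hn (rfl | rfl)
      · rw [abs_of_nonneg (by linarith)]
        exact ⟨hn, id⟩
      · rw [abs_of_nonpos (by linarith)]
        constructor <;> intros <;> linarith
    obtain ⟨hD2, hD'⟩ := key a D ha2 hD
    obtain ⟨hE2, hE'⟩ := key b E hb2 hE
    obtain ⟨hF2, hF'⟩ := key c F hc2 hF
    obtain ⟨h1, h2, h3⟩ := abs_eq_two_of_mul_mul_eq_add hD2 hE2 hF2 hDEF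
    exact hne ⟨mod_cast hD' h1, mod_cast hE' h2, mod_cast hF' h3⟩
  have hlarge : ¬ (A * B + A * C + B * C + A + B + C = 1 ∨
      A * B + A * C + B * C + A + B + C = -1) := by
    have hab : (0 : ℤ) < a * b := by positivity
    have hac : (0 : ℤ) < a * c := by positivity
    have hbc : (0 : ℤ) < b * c := by positivity
    rintro (hE | hE) <;> rcases hA with rfl | rfl <;> rcases hB with rfl | rfl <;>
      rcases hC with rfl | rfl <;>
      first
      | linarith
      | exact hA0 (by linear_combination hE)
      | exact hA2 (by linear_combination hE)
      | exact hB0 (by linear_combination hE)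
      | exact hB2 (by linear_combination hE)
      | exact hC0 (by linear_combination hE)
      | exact hC2 (by linear_combination hE)
  have hsmall₁ := hsmall A B C hA hB hC
  have hsmall₂ := hsmall (-1 - A) (-1 - B) (-1 - C) (by omega) (by omega) (by omega)
  rw [hu₁, hv₁, hu₂, hv₂] at hv
  rcases eisenstein_unit_cases h₃ with ⟨rfl, rfl⟩ | ⟨rfl, rfl⟩ | ⟨rfl, rfl⟩ | ⟨rfl, rfl⟩ |
    ⟨rfl, rfl⟩ | ⟨rfl, rfl⟩ <;>
    first
    | exact hlarge (Or.inl (by linear_combination hv))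
    | exact hlarge (Or.inl (by linear_combination -hv))
    | exact hlarge (Or.inr (by linear_combination hv))
    | exact hlarge (Or.inr (by linear_combination -hv))
    | exact hsmall₁ (Or.inl (by linear_combination hv))
    | exact hsmall₁ (Or.inl (by linear_combination -hv))
    | exact hsmall₁ (Or.inr (by linear_combination hv))
    | exact hsmall₁ (Or.inr (by linear_combination -hv))
    | exact hsmall₂ (Or.inl (by linear_combination hv))
    | exact hsmall₂ (Or.inl (by linear_combination -hv))
    | exact hsmall₂ (Or.inr (by linear_combination hv))
    | exact hsmall₂ (Or.inr (by linear_combination -hv))
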